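/- Let d ≥ 1, let D be a distribution on {0,1}^d, let Y be a metric space with distance ℓ, let f, h_0, h_1 : {0,1}^d → Y, let ε > 0, and let b ∈ {0,1}. If E_{x∼D}[ℓ(h_{1−b}(x), f(x))] > (3+ε)·E_{x∼D}[ℓ(h_b(x), f(x))], then μ = E_{x∼D}[ℓ(h_0(x), h_1(x))] > 0 and R_b < 1/(2+ε) (equivalently, R_b < 1/2 − ε/(2(2+ε))). -/

import Mathlib

/-- `D` is a probability distribution on a finite type: pointwise nonnegative
and summing to one. -/
def IsDist {X : Type*} [Fintype X] (D : X → ℝ) : Prop :=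
  (∀ x, 0 ≤ D x) ∧ ∑ x, D x = 1

/-- The distance from `p` to `q`, weighted by the relative loss of `p` against the target `y`,
is at most the loss of `p`. -/
lemma dist_mul_relative_loss_le {Y : Type*} [PseudoMetricSpace Y] (p q y : Y) :
    dist p q * (dist p y / (dist p y + dist q y)) ≤ dist p y := by
  rw [mul_div_left_comm]
  exact mul_le_of_le_one_right dist_nonneg
    (div_le_one_of_le₀ (dist_triangle_right p q y) (by positivity))

/-- If the expected loss of `h` exceeds `3 + ε` times that of `g`, then `g` and `h` have positive
expected distance, and the relative loss of `g` under the loss-rescaled distribution is less than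
`1 / (2 + ε)`. -/
lemma expected_relative_loss_lt {X Y : Type*} [Fintype X] [PseudoMetricSpace Y]
    {D : X → ℝ} (hD : ∀ x, 0 ≤ D x) (f g h : X → Y) {ε : ℝ} (hε : 0 < ε)
    (hyp : (3 + ε) * ∑ x, D x * dist (g x) (f x) < ∑ x, D x * dist (h x) (f x)) :
    0 < ∑ x, D x * dist (g x) (h x) ∧
    ∑ x, D x * (dist (g x) (h x) / ∑ x', D x' * dist (g x') (h x'))
        * (dist (g x) (f x) / (dist (g x) (f x) + dist (h x) (f x)))
      < 1 / (2 + ε) := by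
  have loss_nonneg : 0 ≤ ∑ x, D x * dist (g x) (f x) :=
    Finset.sum_nonneg fun x _ => mul_nonneg (hD x) dist_nonneg
  have triangle : ∑ x, D x * dist (h x) (f x)
      ≤ ∑ x, D x * dist (g x) (h x) + ∑ x, D x * dist (g x) (f x) := by
    rw [← Finset.sum_add_distrib]
    refine Finset.sum_le_sum fun x _ => ?_
    rw [← mul_add]
    exact mul_le_mul_of_nonneg_left (dist_triangle_left _ _ _) (hD x)
  have loss_lt : (2 + ε) * ∑ x, D x * dist (g x) (f x) < ∑ x, D x * dist (g x) (h x) := by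
    linarith
  set μ := ∑ x, D x * dist (g x) (h x)
  have μ_pos : 0 < μ := lt_of_le_of_lt (by positivity) loss_lt
  refine ⟨μ_pos, ?_⟩
  calc ∑ x, D x * (dist (g x) (h x) / μ)
          * (dist (g x) (f x) / (dist (g x) (f x) + dist (h x) (f x)))
      ≤ ∑ x, D x * dist (g x) (f x) / μ := by
        refine Finset.sum_le_sum fun x _ => ?_
        rw [← mul_div_assoc (D x), div_mul_eq_mul_div, mul_assoc]
        exact div_le_div_of_nonneg_right
          (mul_le_mul_of_nonneg_left (dist_mul_relative_loss_le _ _ _) (hD x)) μ_pos.le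
    _ = (∑ x, D x * dist (g x) (f x)) / μ := (Finset.sum_div _ _ _).symm
    _ < 1 / (2 + ε) := by
        rw [div_lt_div_iff₀ μ_pos (by positivity)]
        linarith

/-- with `h_b = if b then h1 else h0` (for `b : Bool`), if
`E_D[ℓ(h_{1−b}, f)] > (3+ε)·E_D[ℓ(h_b, f)]`, then
`μ = E_D[ℓ(h0, h1)] > 0` and `R_b < 1/(2+ε)`, where
`R_b = ∑_x D(x)·(Δ(x)/μ)·r_b(x)` and `r_b(x) = ℓ_b(x)/(ℓ_0(x)+ℓ_1(x))`
(with value `0` when the denominator vanishes, matching Lean's `x / 0 = 0`). -/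
theorem stmt2 (d : ℕ) (hd : 1 ≤ d) {Y : Type*} [MetricSpace Y]
    (D : (Fin d → Bool) → ℝ) (hD : IsDist D)
    (f h0 h1 : (Fin d → Bool) → Y) (ε : ℝ) (hε : 0 < ε) (b : Bool)
    (hyp : ∑ x, D x * dist ((if b then h0 else h1) x) (f x)
         > (3 + ε) * ∑ x, D x * dist ((if b then h1 else h0) x) (f x)) :
    0 < ∑ x, D x * dist (h0 x) (h1 x) ∧
    ∑ x, D x * (dist (h0 x) (h1 x) / ∑ x', D x' * dist (h0 x') (h1 x'))
        * (dist ((if b then h1 else h0) x) (f x)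
            / (dist (h0 x) (f x) + dist (h1 x) (f x)))
      < 1 / (2 + ε) := by
  cases b
  · simpa using expected_relative_loss_lt hD.1 f h0 h1 hε (by simpa using hyp)
  · simpa [dist_comm (h1 _) (h0 _), add_comm (dist (h1 _) (f _))] using
      expected_relative_loss_lt hD.1 f h1 h0 hε (by simpa using hyp)
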